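/- Let β ≥ 1 and α = β + 1, let 0 < ε < 1, τ > 0, N ∈ ℕ with N ≥ 1, h = 1/N, and C_p := h²/(4 sin²(πh)). Let (v^k)_{k≥0} be a sequence of vectors in ℝ^N with strictly positive entries such that for each k ≥ 1, v^k solves one step of the implicit Euler scheme with datum v^{k−1}, i.e. with cyclic indices, v_i^k − v_i^{k−1} = (ατ/h²)·(v_i^k)^{(α−1)/α}·((v_{i+1}^k)^{β/α} − 2(v_i^k)^{β/α} + (v_{i−1}^k)^{β/α}) for all i. Set u_i^k := (v_i^k)^{1/α}, m := inf_{k≥0, 1≤i≤N} (u_i^k)^{β−1}, and λ := 8ε(α−1)β²·m/(C_p(α+β−1)²). Then: (i) the total mass h·Σ_{i=1}^N u_i^k is nondecreasing in k and converges to some limit U ≥ 0 as k → ∞; (ii) defining the discrete relative entropy Ent(u^k) := (h/(α−1))·Σ_{i=1}^N ((u_i^k)^α − U^α), it holds that Ent(u^k) ≤ (1 + λτ)^{−k}·Ent(u^0) for all k ∈ ℕ. -/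

import Mathlib

open Finset Filter

theorem pm_pointwise (β c u m : ℝ) (hβ : 1 ≤ β) (hc : 0 < c) (hu : 0 < u) (hm : 0 ≤ m)
    (hmc : m ≤ c ^ (β - 1)) (hmu : m ≤ u ^ (β - 1)) :
    m * (u ^ (β + 1) - c ^ (β + 1) - (β + 1) * c ^ β * (u - c)) ≤
      (β + 1) / (2 * β) * (u ^ β - c ^ β) ^ 2 := by
  set φ : ℝ → ℝ := fun s => (β + 1) / (2 * β) * (s ^ β - c ^ β) ^ 2 -
    m * (s ^ (β + 1) - c ^ (β + 1) - (β + 1) * c ^ β * (s - c)) with hφ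
  have hβ0 : 0 < β := by linarith
  have hd : ∀ s, 0 < s → HasDerivAt φ ((β + 1) * (s ^ β - c ^ β) * (s ^ (β - 1) - m)) s := by
    intro s hs
    have h1 : HasDerivAt (fun s : ℝ => s ^ β) (β * s ^ (β - 1)) s :=
      Real.hasDerivAt_rpow_const (Or.inl hs.ne')
    have h2 : HasDerivAt (fun s : ℝ => s ^ (β + 1)) ((β + 1) * s ^ β) s := by
      have := Real.hasDerivAt_rpow_const (x := s) (p := β + 1) (Or.inl hs.ne')
      simpa using this
    have h3 := (((h1.sub_const (c ^ β)).pow 2).const_mul ((β + 1) / (2 * β))).sub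
      (((h2.sub_const (c ^ (β + 1))).sub
        (((hasDerivAt_id s).sub_const c).const_mul ((β + 1) * c ^ β))).const_mul m)
    refine h3.congr_deriv ?_
    simp only [Nat.cast_ofNat, Nat.add_one_sub_one, pow_one, mul_one]
    have e : (β + 1) / (2 * β) * (2 * (s ^ β - c ^ β) * (β * s ^ (β - 1)))
        = (β + 1) * (s ^ β - c ^ β) * s ^ (β - 1) := by
      field_simp
    rw [e]
    ring
  have hφc : φ c = 0 := by simp [hφ]
  suffices 0 ≤ φ u by simp only [hφ] at this; linarith
  rcases le_total c u with hcu | huc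
  · have hmono : MonotoneOn φ (Set.Icc c u) := by
      apply monotoneOn_of_deriv_nonneg (convex_Icc c u)
      · intro s hs; exact (hd s (by linarith [hs.1])).continuousAt.continuousWithinAt
      · intro s hs; rw [interior_Icc] at hs
        exact (hd s (by linarith [hs.1])).differentiableAt.differentiableWithinAt
      · intro s hs; rw [interior_Icc] at hs
        rw [(hd s (by linarith [hs.1])).deriv]
        have a1 : c ^ β ≤ s ^ β := Real.rpow_le_rpow hc.le hs.1.le hβ0.le
        have a2 : c ^ (β - 1) ≤ s ^ (β - 1) := Real.rpow_le_rpow hc.le hs.1.le (by linarith)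
        exact mul_nonneg (mul_nonneg (by linarith) (by linarith)) (by linarith)
    have := hmono (Set.left_mem_Icc.2 hcu) (Set.right_mem_Icc.2 hcu) hcu
    rwa [hφc] at this
  · have hmono : AntitoneOn φ (Set.Icc u c) := by
      apply antitoneOn_of_deriv_nonpos (convex_Icc u c)
      · intro s hs; exact (hd s (by linarith [hs.1])).continuousAt.continuousWithinAt
      · intro s hs; rw [interior_Icc] at hs
        exact (hd s (by linarith [hs.1])).differentiableAt.differentiableWithinAt
      · intro s hs; rw [interior_Icc] at hs
        have hs0 : 0 < s := by linarith [hs.1]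
        rw [(hd s hs0).deriv]
        have a1 : s ^ β ≤ c ^ β := Real.rpow_le_rpow hs0.le hs.2.le hβ0.le
        have a2 : u ^ (β - 1) ≤ s ^ (β - 1) := Real.rpow_le_rpow hu.le hs.1.le (by linarith)
        exact mul_nonpos_of_nonpos_of_nonneg
          (mul_nonpos_of_nonneg_of_nonpos (by linarith) (by linarith)) (by linarith)
    have := hmono (Set.left_mem_Icc.2 huc) (Set.right_mem_Icc.2 huc) huc
    rwa [hφc] at this

theorem pm_tangent (β c u : ℝ) (hβ : 1 ≤ β) (hc : 0 < c) (hu : 0 ≤ u) :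
    c ^ (β + 1) + (β + 1) * c ^ β * (u - c) ≤ u ^ (β + 1) := by
  have h := one_add_mul_self_le_rpow_one_add (s := u / c - 1) (p := β + 1)
    (by have : 0 ≤ u / c := by positivity
        linarith) (by linarith)
  rw [show 1 + (u / c - 1) = u / c by ring, Real.div_rpow hu hc.le,
    le_div_iff₀ (Real.rpow_pos_of_pos hc _)] at h
  have e : c ^ (β + 1) = c ^ β * c := by rw [Real.rpow_add hc, Real.rpow_one]
  refine le_trans (le_of_eq ?_) h
  rw [e]; field_simp

theorem pm_parseval (N : ℕ) [NeZero N] (f : ZMod N → ℂ) :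
    ∑ k, Complex.normSq (ZMod.dft f k) = N * ∑ j, Complex.normSq (f j) := by
  have key : ∑ k, (ZMod.dft f k) * (starRingEnd ℂ) (ZMod.dft f k)
      = N * ∑ j, f j * (starRingEnd ℂ) (f j) := by
    have inv : ∀ j, ∑ k, ZMod.stdAddChar (j * k) * ZMod.dft f k = N * f j := by
      intro j
      have := congrFun (ZMod.dft.symm_apply_apply f) j
      rw [ZMod.invDFT_apply] at this
      rw [← this]
      have hN : (N : ℂ) ≠ 0 := by exact_mod_cast NeZero.ne N
      simp only [smul_eq_mul]
      rw [← mul_assoc, mul_inv_cancel₀ hN, one_mul]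
      simp [mul_comm j]
    have hc : ∀ a : ZMod N, (starRingEnd ℂ) (ZMod.stdAddChar (-a)) = ZMod.stdAddChar a := by
      intro a
      rw [← AddChar.map_neg_eq_conj, neg_neg]
    calc _ = ∑ k, ∑ j, ZMod.dft f k * (ZMod.stdAddChar (j * k) * (starRingEnd ℂ) (f j)) := by
          refine sum_congr rfl fun k _ => ?_
          conv_lhs => rw [ZMod.dft_apply f k, ← ZMod.dft_apply f k]
          rw [← mul_sum]
          congr 1
          rw [ZMod.dft_apply, map_sum]
          refine sum_congr rfl fun j _ => ?_
          rw [smul_eq_mul, map_mul, hc]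
      _ = _ := by
          rw [sum_comm, mul_sum]
          refine sum_congr rfl fun j _ => ?_
          rw [← mul_assoc, ← inv j, sum_mul]
          refine sum_congr rfl fun k _ => ?_
          ring
  have : ((∑ k, Complex.normSq (ZMod.dft f k) : ℝ) : ℂ) = ((N * ∑ j, Complex.normSq (f j) : ℝ) : ℂ) := by
    push_cast
    simp only [Complex.mul_conj] at key
    exact key
  exact_mod_cast this

theorem pm_char (N : ℕ) [NeZero N] (k : ZMod N) (hk : k ≠ 0) :
    4 * Real.sin (Real.pi * (1 / N)) ^ 2 ≤ Complex.normSq ((ZMod.stdAddChar k : ℂ) - 1) := by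
  have hN : (0:ℝ) < N := by exact_mod_cast NeZero.pos N
  have hv1 : 1 ≤ k.val := by
    have := (ZMod.val_ne_zero k).2 hk
    omega
  have hv2 : k.val + 1 ≤ N := ZMod.val_lt k
  have e : (ZMod.stdAddChar k : ℂ) = Complex.exp (Complex.I * ((2 * Real.pi * k.val / N : ℝ) : ℂ)) := by
    rw [ZMod.stdAddChar_apply, ZMod.toCircle_apply]
    congr 1; push_cast; ring
  rw [e, Complex.normSq_eq_norm_sq, Complex.norm_exp_I_mul_ofReal_sub_one, Real.norm_eq_abs, sq_abs]
  have hv1' : (1:ℝ) ≤ k.val := by exact_mod_cast hv1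
  have hv2' : (k.val:ℝ) + 1 ≤ N := by exact_mod_cast hv2
  have hpi := Real.pi_pos
  have l1 : Real.pi * (1 / N) ≤ Real.pi * k.val / N := by
    rw [mul_one_div]; gcongr; nlinarith
  have l2 : Real.pi * k.val / N ≤ Real.pi - Real.pi * (1 / N) := by
    rw [mul_one_div, div_le_iff₀ hN, sub_mul, div_mul_cancel₀ _ hN.ne']; nlinarith
  have l0 : 0 ≤ Real.pi * (1 / N) := by positivity
  have hs := strictConcaveOn_sin_Icc.concaveOn.min_le_of_mem_Icc (x := Real.pi * (1 / N))
    (y := Real.pi - Real.pi * (1 / N)) (z := Real.pi * k.val / N)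
    ⟨l0, by linarith⟩ ⟨by linarith, by linarith⟩ ⟨l1, l2⟩
  rw [Real.sin_pi_sub, min_self] at hs
  have hs0 : 0 ≤ Real.sin (Real.pi * (1 / N)) :=
    Real.sin_nonneg_of_nonneg_of_le_pi l0 (by linarith)
  rw [show 2 * Real.pi * k.val / N / 2 = Real.pi * k.val / N by ring]
  nlinarith

theorem pm_poincare_zmod (N : ℕ) [NeZero N] (f : ZMod N → ℝ) (hf : ∑ i, f i = 0) :
    4 * Real.sin (Real.pi * (1 / N)) ^ 2 * ∑ i, f i ^ 2 ≤ ∑ i, (f (i + 1) - f i) ^ 2 := by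
  have hN : (0:ℝ) < N := by exact_mod_cast NeZero.pos N
  set F : ZMod N → ℂ := fun i => (f i : ℂ)
  set G : ZMod N → ℂ := fun i => ((f (i + 1) - f i : ℝ) : ℂ)
  have hG : ∀ k, ZMod.dft G k = (ZMod.stdAddChar k - 1) * ZMod.dft F k := by
    intro k
    rw [ZMod.dft_apply, ZMod.dft_apply, sub_mul, one_mul, mul_sum]
    have : ∑ j, (ZMod.stdAddChar k : ℂ) * (ZMod.stdAddChar (-(j * k)) • F j)
        = ∑ j, ZMod.stdAddChar (-(j * k)) * F (j + 1) := by
      rw [← Equiv.sum_comp (Equiv.addRight (1 : ZMod N))]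
      refine sum_congr rfl fun j _ => ?_
      simp only [Equiv.coe_addRight, smul_eq_mul]
      rw [← mul_assoc, ← AddChar.map_add_eq_mul]
      congr 2; ring
    rw [this, ← sum_sub_distrib]
    refine sum_congr rfl fun j _ => ?_
    simp only [F, G, smul_eq_mul]; push_cast; ring
  have h0 : ZMod.dft F 0 = 0 := by
    rw [ZMod.dft_apply]
    simp only [mul_zero, neg_zero, AddChar.map_zero_eq_one, one_smul, F]
    exact_mod_cast hf
  have pF := pm_parseval N F
  have pG := pm_parseval N G
  have hle : 4 * Real.sin (Real.pi * (1 / N)) ^ 2 * ∑ k, Complex.normSq (ZMod.dft F k) ≤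
      ∑ k, Complex.normSq (ZMod.dft G k) := by
    rw [mul_sum]
    refine sum_le_sum fun k _ => ?_
    rw [hG, map_mul]
    by_cases hk : k = 0
    · subst hk; simp [h0]
    · exact mul_le_mul_of_nonneg_right (pm_char N k hk) (Complex.normSq_nonneg _)
  rw [pF, pG] at hle
  simp only [F, G, Complex.normSq_ofReal, ← pow_two] at hle
  have : (N:ℝ) * (4 * Real.sin (Real.pi * (1 / N)) ^ 2 * ∑ i, f i ^ 2) ≤
    N * ∑ i, (f (i + 1) - f i) ^ 2 := by linarith
  exact le_of_mul_le_mul_left this hN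

theorem pm_poincare (N : ℕ) [hN : NeZero N] (f : Fin N → ℝ) (hf : ∑ i, f i = 0) :
    4 * Real.sin (Real.pi * (1 / N)) ^ 2 * ∑ i, f i ^ 2 ≤ ∑ i, (f (i + 1) - f i) ^ 2 := by
  cases N with
  | zero => exact absurd rfl hN.out
  | succ n => exact pm_poincare_zmod (n + 1) f hf

theorem pm_summation (N : ℕ) [NeZero N] (w : Fin N → ℝ) :
    ∑ i, w i * (w (i + 1) - 2 * w i + w (i - 1)) = - ∑ i, (w (i + 1) - w i) ^ 2 := by
  have e1 : ∑ i, w (i + 1) ^ 2 = ∑ i, w i ^ 2 :=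
    Equiv.sum_comp (Equiv.addRight (1 : Fin N)) (fun i => w i ^ 2)
  have e2 : ∑ i, w i * w (i - 1) = ∑ i, w (i + 1) * w i := by
    rw [← Equiv.sum_comp (Equiv.addRight (1 : Fin N))]
    simp
  have : ∑ i, w i * (w (i + 1) - 2 * w i + w (i - 1)) + ∑ i, (w (i + 1) - w i) ^ 2
      = (∑ i, w i * w (i - 1) - ∑ i, w (i + 1) * w i) + (∑ i, w (i + 1) ^ 2 - ∑ i, w i ^ 2) := by
    simp only [← sum_add_distrib, ← sum_sub_distrib]
    refine sum_congr rfl fun i _ => ?_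
    ring
  linarith

theorem pm_lap_zero (N : ℕ) [NeZero N] (w : Fin N → ℝ) :
    ∑ i, (w (i + 1) - 2 * w i + w (i - 1)) = 0 := by
  have e1 : ∑ i, w (i + 1) = ∑ i, w i := Equiv.sum_comp (Equiv.addRight (1 : Fin N)) w
  have e2 : ∑ i, w (i - 1) = ∑ i, w i := Equiv.sum_comp (Equiv.subRight (1 : Fin N)) w
  simp only [sum_add_distrib, sum_sub_distrib, ← mul_sum]
  linarith

/-- functional inequality -/
theorem pm_functional (N : ℕ) [NeZero N] (β m U : ℝ) (hβ : 1 ≤ β) (hm : 0 ≤ m)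
    (u : Fin N → ℝ) (hu : ∀ i, 0 < u i) (hmu : ∀ i, m ≤ u i ^ (β - 1))
    (hU0 : 0 ≤ U) (hU : ∑ i, u i ≤ N * U) :
    2 * β * m * (4 * Real.sin (Real.pi * (1 / N)) ^ 2) * ∑ i, (u i ^ (β + 1) - U ^ (β + 1)) ≤
      (β + 1) * ∑ i, (u (i + 1) ^ β - u i ^ β) ^ 2 := by
  have hN : (0:ℝ) < N := by exact_mod_cast NeZero.pos N
  have hβ0 : 0 < β := by linarith
  obtain ⟨i0, -, hi0⟩ := exists_min_image (univ : Finset (Fin N)) u univ_nonempty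
  set W : ℝ := (∑ i, u i ^ β) / N with hW
  have hWge : u i0 ^ β ≤ W := by
    rw [hW, le_div_iff₀ hN]
    have := card_nsmul_le_sum (univ : Finset (Fin N)) (fun i => u i ^ β) (u i0 ^ β)
      (fun i hi => Real.rpow_le_rpow (hu _).le (hi0 i hi) hβ0.le)
    simp at this; linarith
  have hWpos : 0 < W := lt_of_lt_of_le (Real.rpow_pos_of_pos (hu i0) _) hWge
  set c : ℝ := W ^ (1 / β) with hcdef
  have hc : 0 < c := Real.rpow_pos_of_pos hWpos _
  have hcW : c ^ β = W := by
    rw [hcdef, ← Real.rpow_mul hWpos.le, one_div_mul_cancel hβ0.ne', Real.rpow_one]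
  have hcu : u i0 ≤ c := by
    rw [← hcW] at hWge
    exact (Real.rpow_le_rpow_iff (hu _).le hc.le hβ0).1 hWge
  have hmc : m ≤ c ^ (β - 1) :=
    (hmu i0).trans (Real.rpow_le_rpow (hu _).le hcu (by linarith))
  have hsum0 : ∑ i, (u i ^ β - W) = 0 := by
    rw [sum_sub_distrib]; simp [hW]; field_simp; simp
  have hP := pm_poincare N (fun i => u i ^ β - W) hsum0
  simp only [sub_sub_sub_cancel_right] at hP
  have hpt : m * ∑ i, (u i ^ (β + 1) - c ^ (β + 1) - (β + 1) * c ^ β * (u i - c)) ≤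
      (β + 1) / (2 * β) * ∑ i, (u i ^ β - W) ^ 2 := by
    rw [mul_sum, mul_sum]
    refine sum_le_sum fun i _ => ?_
    rw [← hcW]
    exact pm_pointwise β c (u i) m hβ hc (hu i) hm hmc (hmu i)
  have hS : ∑ i, (u i ^ (β + 1) - U ^ (β + 1)) ≤
      ∑ i, (u i ^ (β + 1) - c ^ (β + 1) - (β + 1) * c ^ β * (u i - c)) := by
    have ht := pm_tangent β c U hβ hc hU0
    simp only [sum_sub_distrib, ← mul_sum]
    simp only [sum_const, card_univ, Fintype.card_fin, nsmul_eq_mul]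
    have hK : 0 ≤ (β + 1) * c ^ β := by positivity
    have := mul_le_mul_of_nonneg_left hU hK
    have := mul_le_mul_of_nonneg_left ht hN.le
    linarith
  set s := 4 * Real.sin (Real.pi * (1 / N)) ^ 2 with hs
  have hs0 : 0 ≤ s := by positivity
  calc _ = 2 * β * s * (m * ∑ i, (u i ^ (β + 1) - U ^ (β + 1))) := by ring
    _ ≤ 2 * β * s * ((β + 1) / (2 * β) * ∑ i, (u i ^ β - W) ^ 2) := by
      refine mul_le_mul_of_nonneg_left ?_ (by positivity)
      exact (mul_le_mul_of_nonneg_left hS hm).trans hpt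
    _ = (β + 1) * (s * ∑ i, (u i ^ β - W) ^ 2) := by field_simp
    _ ≤ _ := by gcongr

/-- Main theorem (on the line α − β = 1): monotone convergence of the total
mass and exponential decay of the discrete relative entropy for the fully
discrete porous-medium scheme. -/
theorem discrete_porous_medium_entropy_decay
    (β : ℝ) (hβ : 1 ≤ β) (α : ℝ) (hαβ : α = β + 1)
    (ε : ℝ) (hε0 : 0 < ε) (hε1 : ε < 1)
    (τ : ℝ) (hτ : 0 < τ)
    (N : ℕ) [NeZero N] (h : ℝ) (hh : h = 1 / N)
    (Cp : ℝ) (hCp : Cp = h ^ 2 / (4 * Real.sin (Real.pi * h) ^ 2))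
    (v : ℕ → Fin N → ℝ) (hv : ∀ k i, 0 < v k i)
    (hscheme : ∀ k : ℕ, 1 ≤ k → ∀ i : Fin N,
      v k i - v (k - 1) i = α * τ / h ^ 2 * v k i ^ ((α - 1) / α) *
        (v k (i + 1) ^ (β / α) - 2 * v k i ^ (β / α) + v k (i - 1) ^ (β / α)))
    (u : ℕ → Fin N → ℝ) (hu : ∀ k i, u k i = v k i ^ (1 / α))
    (m lam : ℝ)
    (hm : m = ⨅ (k : ℕ) (i : Fin N), u k i ^ (β - 1))
    (hlam : lam = 8 * ε * (α - 1) * β ^ 2 * m / (Cp * (α + β - 1) ^ 2)) :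
    ∃ U : ℝ, 0 ≤ U ∧
      Monotone (fun k : ℕ => h * ∑ i : Fin N, u k i) ∧
      Tendsto (fun k : ℕ => h * ∑ i : Fin N, u k i) atTop (nhds U) ∧
      ∀ k : ℕ,
        h / (α - 1) * ∑ i : Fin N, (u k i ^ α - U ^ α)
          ≤ (1 + lam * τ)⁻¹ ^ k *
            (h / (α - 1) * ∑ i : Fin N, (u 0 i ^ α - U ^ α)) := by
  subst hαβ
  have hβ0 : 0 < β := by linarith
  have hα0 : 0 < β + 1 := by linarith
  have hN : (0:ℝ) < N := by exact_mod_cast NeZero.pos N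
  have hh0 : 0 < h := by rw [hh]; positivity
  have hNh : (N:ℝ) * h = 1 := by rw [hh]; field_simp
  have hup : ∀ k i, 0 < u k i := fun k i => by rw [hu]; exact Real.rpow_pos_of_pos (hv k i) _
  have huα : ∀ k i, u k i ^ (β + 1) = v k i := fun k i => by
    rw [hu, ← Real.rpow_mul (hv k i).le, one_div_mul_cancel hα0.ne', Real.rpow_one]
  have huβ : ∀ k i, v k i ^ (β / (β + 1)) = u k i ^ β := fun k i => by
    rw [hu, ← Real.rpow_mul (hv k i).le]; congr 1; ring
  have hstep : ∀ k i, u (k + 1) i ^ (β + 1) - u k i ^ (β + 1) = (β + 1) * τ / h ^ 2 *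
      (u (k + 1) i ^ β * (u (k + 1) (i + 1) ^ β - 2 * u (k + 1) i ^ β + u (k + 1) (i - 1) ^ β)) := by
    intro k i
    have := hscheme (k + 1) (by omega) i
    simp only [add_sub_cancel_right, Nat.add_sub_cancel, huβ] at this
    rw [huα, huα, this]; ring
  have hdiss : ∀ k, ∑ i, u (k + 1) i ^ (β + 1) - ∑ i, u k i ^ (β + 1) =
      - ((β + 1) * τ / h ^ 2 * ∑ i, (u (k + 1) (i + 1) ^ β - u (k + 1) i ^ β) ^ 2) := by
    intro k
    rw [← sum_sub_distrib, sum_congr rfl (fun i _ => hstep k i), ← mul_sum,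
      pm_summation N (fun i => u (k + 1) i ^ β)]
    ring
  have hanti : Antitone (fun k => ∑ i, u k i ^ (β + 1)) := by
    refine antitone_nat_of_succ_le fun k => ?_
    have h1 := hdiss k
    have h2 : 0 ≤ (β + 1) * τ / h ^ 2 * ∑ i, (u (k + 1) (i + 1) ^ β - u (k + 1) i ^ β) ^ 2 :=
      mul_nonneg (by positivity) (sum_nonneg fun i _ => sq_nonneg _)
    linarith
  have hmono : Monotone (fun k : ℕ => h * ∑ i : Fin N, u k i) := by
    refine monotone_nat_of_le_succ fun k => ?_
    refine mul_le_mul_of_nonneg_left ?_ hh0.le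
    have key : ∀ i, τ / h ^ 2 * (u (k + 1) (i + 1) ^ β - 2 * u (k + 1) i ^ β
        + u (k + 1) (i - 1) ^ β) ≤ u (k + 1) i - u k i := by
      intro i
      have ht := pm_tangent β (u (k + 1) i) (u k i) hβ (hup _ _) (hup _ _).le
      have hs := hstep k i
      have hp : 0 < (β + 1) * u (k + 1) i ^ β :=
        mul_pos hα0 (Real.rpow_pos_of_pos (hup _ _) _)
      refine le_of_mul_le_mul_left ?_ hp
      have : (β + 1) * τ / h ^ 2 *
        (u (k + 1) i ^ β * (u (k + 1) (i + 1) ^ β - 2 * u (k + 1) i ^ β + u (k + 1) (i - 1) ^ β))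
        = (β + 1) * u (k + 1) i ^ β * (τ / h ^ 2 * (u (k + 1) (i + 1) ^ β - 2 * u (k + 1) i ^ β
        + u (k + 1) (i - 1) ^ β)) := by ring
      rw [← this, ← hs]
      linarith
    have hsum := sum_le_sum (s := univ) (fun i _ => key i)
    rw [← mul_sum, pm_lap_zero N (fun i => u (k + 1) i ^ β), mul_zero, sum_sub_distrib] at hsum
    linarith
  have hbdd : BddAbove (Set.range (fun k : ℕ => h * ∑ i : Fin N, u k i)) := by
    refine ⟨h * (∑ i : Fin N, 1 + ∑ i, u 0 i ^ (β + 1)), ?_⟩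
    rintro _ ⟨k, rfl⟩
    refine mul_le_mul_of_nonneg_left ?_ hh0.le
    have h1 : ∑ i, u k i ≤ ∑ i, (1 + u k i ^ (β + 1)) := by
      refine sum_le_sum fun i _ => ?_
      have hp := Real.rpow_pos_of_pos (hup k i) (β + 1)
      rcases le_total (u k i) 1 with h1 | h1
      · linarith
      · have := Real.self_le_rpow_of_one_le h1 (show 1 ≤ β + 1 by linarith)
        linarith
    rw [sum_add_distrib] at h1
    have h2 := hanti (Nat.zero_le k)
    simp only at h2
    linarith
  set U : ℝ := ⨆ k : ℕ, h * ∑ i : Fin N, u k i with hUdef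
  have hUle : ∀ k, h * ∑ i : Fin N, u k i ≤ U := fun k => le_ciSup hbdd k
  have hU0 : 0 ≤ U := le_trans
    (mul_nonneg hh0.le (sum_nonneg fun i _ => (hup 0 i).le)) (hUle 0)
  have hUle' : ∀ k, ∑ i : Fin N, u k i ≤ N * U := by
    intro k
    have := mul_le_mul_of_nonneg_left (hUle k) hN.le
    rwa [← mul_assoc, hNh, one_mul] at this
  have hpn : ∀ k i, 0 ≤ u k i ^ (β - 1) := fun k i => (Real.rpow_pos_of_pos (hup k i) _).le
  have hm0 : 0 ≤ m := by
    rw [hm]; exact Real.iInf_nonneg fun k => Real.iInf_nonneg fun i => hpn k i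
  have hmle : ∀ k i, m ≤ u k i ^ (β - 1) := by
    intro k i
    rw [hm]
    refine (ciInf_le ⟨0, ?_⟩ k).trans (ciInf_le ⟨0, ?_⟩ i)
    · rintro _ ⟨k, rfl⟩; exact Real.iInf_nonneg fun i => hpn k i
    · rintro _ ⟨i, rfl⟩; exact hpn k i
  have hlam2 : lam * h ^ 2 = ε * (2 * β * m * (4 * Real.sin (Real.pi * (1 / N)) ^ 2)) := by
    rw [hlam, hCp, ← hh]
    by_cases hs : Real.sin (Real.pi * h) = 0
    · simp [hs]
    · rw [show β + 1 + β - 1 = 2 * β by ring, show β + 1 - 1 = β by ring]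
      field_simp
      ring
  have hlam0 : 0 ≤ lam := by
    have : 0 ≤ lam * h ^ 2 := by rw [hlam2]; positivity
    exact nonneg_of_mul_nonneg_left this (by positivity)
  have hden : 0 < 1 + lam * τ := by positivity
  refine ⟨U, hU0, hmono, tendsto_atTop_ciSup hmono hbdd, ?_⟩
  have hone : ∀ k, (1 + lam * τ) * ∑ i, (u (k + 1) i ^ (β + 1) - U ^ (β + 1)) ≤
      ∑ i, (u k i ^ (β + 1) - U ^ (β + 1)) := by
    intro k
    have hf := pm_functional N β m U hβ hm0 (u (k + 1)) (hup _) (hmle _) hU0 (hUle' _)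
    have hd := hdiss k
    set S := ∑ i, (u (k + 1) i ^ (β + 1) - U ^ (β + 1)) with hS
    set D := ∑ i, (u (k + 1) (i + 1) ^ β - u (k + 1) i ^ β) ^ 2 with hD
    have hD0 : 0 ≤ D := sum_nonneg fun i _ => sq_nonneg _
    have hmain : lam * h ^ 2 * S ≤ (β + 1) * D := by
      rw [hlam2]
      rcases le_total S 0 with h0 | h0
      · exact (mul_nonpos_of_nonneg_of_nonpos (by positivity) h0).trans (by positivity)
      · rw [mul_assoc]
        refine le_trans ?_ hf
        exact mul_le_of_le_one_left (by positivity) hε1.le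
    have hmain2 : lam * τ * S ≤ (β + 1) * τ / h ^ 2 * D := by
      have h2 : 0 < h ^ 2 := by positivity
      have := mul_le_mul_of_nonneg_left hmain (show 0 ≤ τ / h ^ 2 by positivity)
      calc lam * τ * S = τ / h ^ 2 * (lam * h ^ 2 * S) := by field_simp
        _ ≤ _ := this
        _ = _ := by ring
    have hdS : S - ∑ i, (u k i ^ (β + 1) - U ^ (β + 1)) = - ((β + 1) * τ / h ^ 2 * D) := by
      rw [← hd, hS, sum_sub_distrib, sum_sub_distrib]; ring
    linarith
  have hK : 0 ≤ h / (β + 1 - 1) := by rw [add_sub_cancel_right]; positivity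
  have hall : ∀ k, ∑ i, (u k i ^ (β + 1) - U ^ (β + 1)) ≤
      (1 + lam * τ)⁻¹ ^ k * ∑ i, (u 0 i ^ (β + 1) - U ^ (β + 1)) := by
    intro k
    induction k with
    | zero => simp
    | succ k ih =>
      have h1 := (hone k).trans ih
      rw [pow_succ', mul_assoc, ← div_eq_inv_mul, le_div_iff₀ hden]
      linarith
  intro k
  calc _ ≤ h / (β + 1 - 1) * ((1 + lam * τ)⁻¹ ^ k * ∑ i, (u 0 i ^ (β + 1) - U ^ (β + 1))) :=
        mul_le_mul_of_nonneg_left (hall k) hK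
    _ = _ := by ring
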